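/- Let A and B be finite-dimensional algebras over a field k and M a Frobenius B-A-bimodule which is faithful as a left B-module and as a right A-module. Let X be a finitely generated A-module with add(X) = A-stp and Y a finitely generated B-module with add(Y) = B-stp. Then the canonical algebra homomorphisms φ: End_A(X) → End_B(M ⊗_A X), f ↦ id_M ⊗ f, and ψ: End_B(Y) → End_A(Hom_B(M, Y)), g ↦ Hom_B(M, g), are both injective, and each of φ and ψ is a Frobenius extension of algebras that is split both as a homomorphism of left modules and as a homomorphism of right modules over the source algebra. -/

import Mathlib

/-!
Statement 7: Let `A`, `B` be finite-dimensional algebras over a field `k` and `M` a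
Frobenius `B`-`A`-bimodule, faithful as a left `B`-module and as a right `A`-module.
Let `X`, `Y` be finitely generated modules with `add(X) = A`-stp and `add(Y) = B`-stp.
Then the canonical algebra homomorphisms `φ : End_A(X) → End_B(M ⊗_A X)`,
`f ↦ id_M ⊗ f`, and `ψ : End_B(Y) → End_A(Hom_B(M, Y))`, `g ↦ Hom_B(M, g)`, are injective,
and both are Frobenius extensions which are split as maps of left modules and of right
modules over the source algebra.
-/

universe u
open MulOpposite
section FrobeniusBimodule

variable (S R M : Type u) [Ring S] [Ring R] [AddCommGroup M]
  [Module S M] [Module Rᵐᵒᵖ M] [SMulCommClass S Rᵐᵒᵖ M] [SMulCommClass Rᵐᵒᵖ S M]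

/-- The right action of `r : R` on the `S`-`R`-bimodule `M`, as an `S`-linear map. -/
def ract (r : R) : M →ₗ[S] M where
  toFun m := op r • m
  map_add' _ _ := smul_add _ _ _
  map_smul' s m := smul_comm (op r) s m

/-- The left action of `s : S` on the `S`-`R`-bimodule `M`, as a right `R`-linear map. -/
def lact (s : S) : M →ₗ[Rᵐᵒᵖ] M where
  toFun m := s • m
  map_add' _ _ := smul_add _ _ _
  map_smul' r m := smul_comm s r m

/-- Left multiplication by `r : R` on `R`, as a right `R`-linear map. -/
def mulLeft' (r : R) : R →ₗ[Rᵐᵒᵖ] R where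
  toFun x := r * x
  map_add' := mul_add r
  map_smul' a x := by
    simp only [MulOpposite.smul_eq_mul_unop, RingHom.id_apply, mul_assoc]

/-- An `S`-`R`-bimodule `M` is a Frobenius bimodule if it is finitely generated projective
as a left `S`-module and as a right `R`-module, and `Hom_S(M, S) ≅ Hom_{Rᵒᵖ}(M, R)` as
`R`-`S`-bimodules.  Here `Hom_S(M, S)` is an `R`-`S`-bimodule via `(r • f • s) m = f (m r) s`,
and `Hom_{Rᵒᵖ}(M, R)` is an `R`-`S`-bimodule via `(r • g • s) m = r * g (s • m)`; the
bimodule conditions on the additive isomorphism `e` are stated via the two compatibilities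
below. -/
def IsFrobeniusBimodule : Prop :=
  Module.Finite S M ∧ Module.Projective S M ∧
  Module.Finite Rᵐᵒᵖ M ∧ Module.Projective Rᵐᵒᵖ M ∧
  ∃ e : (M →ₗ[S] S) ≃+ (M →ₗ[Rᵐᵒᵖ] R),
    (∀ (r : R) (f : M →ₗ[S] S), e (f ∘ₗ ract S R M r) = mulLeft' R r ∘ₗ e f) ∧
    (∀ (s : S) (f : M →ₗ[S] S),
      e (LinearMap.toSpanSingleton S S s ∘ₗ f) = e f ∘ₗ lact S R M s)

variable (Y : Type u) [AddCommGroup Y] [Module S Y]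

/-- `Hom_S(M, Y)` is a left `R`-module via the right action of `R` on `M`:
`(r • f) m = f (m r)`. -/
instance homLeftModule : Module R (M →ₗ[S] Y) where
  smul r f := f ∘ₗ ract S R M r
  one_smul f := by ext m; show f _ = f m; simp [ract]
  mul_smul r r' f := by ext m; show f _ = f _; simp [ract, op_mul, mul_smul]
  smul_zero r := rfl
  smul_add r f g := rfl
  add_smul r r' f := by ext m; show f _ = f _ + f _; simp [ract, op_add, add_smul, map_add]
  zero_smul f := by ext m; show f _ = 0; simp [ract]

/-- The left `R`-action on `Hom_S(M, Y)` through the domain commutes with any compatible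
action on the codomain. -/
instance homActionsComm (T : Type u) [Ring T] [Module T Y] [SMulCommClass S T Y] :
    SMulCommClass T R (M →ₗ[S] Y) :=
  ⟨fun _ _ _ => rfl⟩

end FrobeniusBimodule
section NCTensor

variable (R : Type u) [Ring R] (M : Type u) [AddCommGroup M] [Module Rᵐᵒᵖ M]
  (X : Type u) [AddCommGroup X] [Module R X]
  (S : Type u) [Ring S] [Module S M] [SMulCommClass Rᵐᵒᵖ S M]

/-- The submodule of balanced relations in `M ⊗[ℤ] X`, where `M` is an `S`-`R`-bimodule
and `X` a left `R`-module.  Since the generating set is stable under the action of `S`,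
its `S`-span coincides with its additive span. -/
def balS : Submodule S (TensorProduct ℤ M X) :=
  Submodule.span S
    {z | ∃ (m : M) (r : R) (x : X), z = m ⊗ₜ[ℤ] (r • x) - ((op r) • m) ⊗ₜ[ℤ] x}

/-- The tensor product `M ⊗_R X` over the (possibly noncommutative) ring `R`, for a right
`R`-module `M` and a left `R`-module `X`: the quotient of `M ⊗[ℤ] X` by the balanced
relations.  When `M` is an `S`-`R`-bimodule this is a left `S`-module. -/
def NCT := (TensorProduct ℤ M X) ⧸ balS R M X S

noncomputable instance : AddCommGroup (NCT R M X S) :=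
  inferInstanceAs (AddCommGroup ((TensorProduct ℤ M X) ⧸ balS R M X S))

noncomputable instance : Module S (NCT R M X S) :=
  inferInstanceAs (Module S ((TensorProduct ℤ M X) ⧸ balS R M X S))

/-- The class of the pure tensor `m ⊗ x` in `M ⊗_R X`. -/
noncomputable def mkT (m : M) (x : X) : NCT R M X S :=
  Submodule.Quotient.mk (m ⊗ₜ[ℤ] x)

end NCTensor
section Nakayama

variable (k : Type u) [Field k] (A : Type u) [Ring A] [Algebra k A]

/-- The Nakayama functor `ν_A = D Hom_A(-, A)` on (the objects of) the category of left
`A`-modules, where `D = Hom_k(-, k)` is the `k`-dual: `Hom_A(X, A)` is a right `A`-module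
via right multiplication on `A`, and its `k`-dual is a left `A`-module. -/
noncomputable def nak (X : ModuleCat.{u} A) : ModuleCat.{u} A :=
  ModuleCat.of A ((↑X →ₗ[A] A) →ₗ[k] k)

/-- A finitely generated projective `A`-module `P` is `ν`-stably projective if `ν_A^i P` is
projective for all `i > 0`. -/
noncomputable def IsStp (P : ModuleCat.{u} A) : Prop :=
  Module.Finite A P ∧ Module.Projective A P ∧
    ∀ i : ℕ, 0 < i → Module.Projective A ((nak k A)^[i] P)

/-- `Y` belongs to `add X`: `Y` is a direct summand of a finite direct sum of copies
of `X`. -/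
def InAdd (X Y : ModuleCat.{u} A) : Prop :=
  ∃ (n : ℕ) (f : Y →ₗ[A] (Fin n → X)) (g : (Fin n → X) →ₗ[A] Y),
    g ∘ₗ f = LinearMap.id

end Nakayama
section FrobeniusRingHom

variable {Γ Λ : Type u} [Ring Γ] [Ring Λ]

/-- A ring homomorphism `ι : Γ → Λ` is a Frobenius extension if `Λ`, regarded as a
`Γ`-bimodule via `ι`, is finitely generated projective as a left `Γ`-module and
`Λ ≅ Hom_Γ(Λ, Γ)` as `Λ`-`Γ`-bimodules.  Here the left `Λ`-action on `Hom_Γ(Λ, Γ)` is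
`(l • f) x = f (x * l)` and the right `Γ`-action is `(f • γ) x = f x * γ`, so the two
compatibilities below say exactly that the additive isomorphism `e` is an isomorphism of
`Λ`-`Γ`-bimodules. -/
def IsFrobeniusRingHom (ι : Γ →+* Λ) : Prop :=
  letI : Module Γ Λ := Module.compHom Λ ι
  Module.Finite Γ Λ ∧ Module.Projective Γ Λ ∧
  ∃ e : Λ ≃+ (Λ →ₗ[Γ] Γ),
    (∀ (l x y : Λ), e (l * x) y = e x (y * l)) ∧
    (∀ (γ : Γ) (x y : Λ), e (x * ι γ) y = e x y * γ)

/-- `ι : Γ → Λ` is a split monomorphism of left `Γ`-modules, where `Λ` is a left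
`Γ`-module via `ι`. -/
def IsLeftSplitRingHom (ι : Γ →+* Λ) : Prop :=
  ∃ π : Λ →+ Γ, (∀ (γ : Γ) (x : Λ), π (ι γ * x) = γ * π x) ∧ ∀ γ : Γ, π (ι γ) = γ

/-- `ι : Γ → Λ` is a split monomorphism of right `Γ`-modules, where `Λ` is a right
`Γ`-module via `ι`. -/
def IsRightSplitRingHom (ι : Γ →+* Λ) : Prop :=
  ∃ π : Λ →+ Γ, (∀ (γ : Γ) (x : Λ), π (x * ι γ) = π x * γ) ∧ ∀ γ : Γ, π (ι γ) = γ

end FrobeniusRingHom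

section StablyProjective

theorem exists_dual_basis (R P : Type u) [Ring R] [AddCommGroup P] [Module R P]
    [Module.Finite R P] [Module.Projective R P] :
    ∃ (n : ℕ) (p : Fin n → P) (θ : Fin n → P →ₗ[R] R), ∀ x, ∑ i, θ i x • p i = x := by
  obtain ⟨n, f, hf⟩ := Module.Finite.exists_fin' R P
  obtain ⟨g, hg⟩ := Module.projective_lifting_property f LinearMap.id hf
  refine ⟨n, fun i => f (Pi.single i 1), fun i => LinearMap.proj i ∘ₗ g, fun x => ?_⟩
  conv_rhs => rw [← LinearMap.id_apply (R := R) x, ← hg, LinearMap.comp_apply,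
    pi_eq_sum_univ' (g x), map_sum]
  refine Finset.sum_congr rfl fun i _ => ?_
  rw [map_smul]
  congr 2

theorem eq_sum_of_dual_basis {R P : Type u} [Ring R] [AddCommGroup P] [Module R P] {n : ℕ}
    {p : Fin n → P} {θ : Fin n → P →ₗ[R] R} (h : ∀ x, ∑ i, θ i x • p i = x) (t : P →ₗ[R] R) :
    ∑ i, op (t (p i)) • θ i = t := by
  ext x
  conv_rhs => rw [← h x]
  simp

variable {k : Type u} [Field k] {A : Type u} [Ring A] [Algebra k A]

/-- The `A`-linear map `Z → D Hom_A(P, A)` attached to a `k`-linear functional on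
`Hom_A(P, Z)`. -/
def nakayamaLift (P Z : Type u) [AddCommGroup P] [Module A P] [AddCommGroup Z] [Module A Z]
    [Module k Z] [IsScalarTower k A Z] [SMulCommClass A k Z]
    (l : (P →ₗ[A] Z) →ₗ[k] k) : Z →ₗ[A] ((P →ₗ[A] A) →ₗ[k] k) where
  toFun z :=
    { toFun := fun t => l (LinearMap.toSpanSingleton A Z z ∘ₗ t)
      map_add' := fun t t' => by rw [LinearMap.comp_add, map_add]
      map_smul' := fun c t => by
        rw [RingHom.id_apply, ← map_smul]
        congr 1
        ext p
        simp }
  map_add' z z' := by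
    ext t
    change l _ = l _ + l _
    rw [← map_add]
    congr 1
    ext p
    simp
  map_smul' a z := by
    ext t
    change l _ = l (LinearMap.toSpanSingleton A Z z ∘ₗ (op a • t))
    congr 1
    ext p
    simp [mul_smul]

theorem nakayamaLift_apply (P Z : Type u) [AddCommGroup P] [Module A P] [AddCommGroup Z]
    [Module A Z] [Module k Z] [IsScalarTower k A Z] [SMulCommClass A k Z]
    (l : (P →ₗ[A] Z) →ₗ[k] k) (z : Z) (t : P →ₗ[A] A) :
    nakayamaLift P Z l z t = l (LinearMap.toSpanSingleton A Z z ∘ₗ t) := rfl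

theorem nakayama_expand {P Z : Type u} [AddCommGroup P] [Module A P] [AddCommGroup Z]
    [Module A Z] {n : ℕ} {p : Fin n → P} {θ : Fin n → P →ₗ[A] A}
    (hp : ∀ x, ∑ i, θ i x • p i = x) (h : Z →ₗ[A] ((P →ₗ[A] A) →ₗ[k] k)) (z : Z)
    (t : P →ₗ[A] A) : h z t = ∑ i, h (t (p i) • z) (θ i) := by
  conv_lhs => rw [← eq_sum_of_dual_basis hp t, map_sum]
  refine Finset.sum_congr rfl fun i _ => ?_
  exact (LinearMap.congr_fun (map_smul h (t (p i)) z) (θ i)).symm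

/-- There is a nonzero `A`-linear map from `X` to `Z`. -/
def HasHom (X Z : ModuleCat.{u} A) : Prop := ∃ f : X →ₗ[A] Z, f ≠ 0

section

variable (P Z : Type u) [AddCommGroup P] [Module A P] [Module.Finite A P]
    [Module.Projective A P] [AddCommGroup Z] [Module A Z]

theorem exists_hom_nakayama_of_exists_hom (hu : ∃ u : P →ₗ[A] Z, u ≠ 0) :
    ∃ h : Z →ₗ[A] ((P →ₗ[A] A) →ₗ[k] k), h ≠ 0 := by
  let : Module k Z := Module.compHom Z (algebraMap k A)
  have : IsScalarTower k A Z := ⟨fun c a z => by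
    change _ = algebraMap k A c • a • z
    rw [Algebra.smul_def, mul_smul]⟩
  have : SMulCommClass A k Z := ⟨fun a c z => by
    change a • algebraMap k A c • z = algebraMap k A c • a • z
    rw [← mul_smul, ← mul_smul, Algebra.commutes]⟩
  obtain ⟨u, hu⟩ := hu
  obtain ⟨n, p, θ, hp⟩ := exists_dual_basis A P
  obtain ⟨l, hl⟩ : ∃ l : Module.Dual k (P →ₗ[A] Z), l u ≠ 0 := by
    by_contra! h0
    exact hu ((Module.forall_dual_apply_eq_zero_iff k u).mp h0)
  refine ⟨nakayamaLift P Z l, fun h0 => hl ?_⟩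
  have : u = ∑ i, LinearMap.toSpanSingleton A Z (u (p i)) ∘ₗ θ i := by
    ext x
    conv_lhs => rw [← hp x]
    simp
  rw [this, map_sum]
  refine Finset.sum_eq_zero fun i _ => ?_
  rw [← nakayamaLift_apply, h0]
  rfl

theorem exists_hom_of_exists_hom_nakayama
    (hh : ∃ h : Z →ₗ[A] ((P →ₗ[A] A) →ₗ[k] k), h ≠ 0) : ∃ u : P →ₗ[A] Z, u ≠ 0 := by
  obtain ⟨h, hh⟩ := hh
  obtain ⟨n, p, θ, hp⟩ := exists_dual_basis A P
  by_contra! h0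
  refine hh (LinearMap.ext fun z => LinearMap.ext fun t => ?_)
  rw [nakayama_expand hp]
  refine Finset.sum_eq_zero fun i _ => ?_
  have := LinearMap.congr_fun (h0 (LinearMap.toSpanSingleton A Z z ∘ₗ t)) (p i)
  simp only [LinearMap.comp_apply, LinearMap.toSpanSingleton_apply, LinearMap.zero_apply] at this
  rw [this, map_zero]
  rfl

theorem injective_nakayama : Module.Injective A ((P →ₗ[A] A) →ₗ[k] k) := by
  refine ⟨fun Z Z' _ _ _ _ i hi h => ?_⟩
  let : Module k Z := Module.compHom Z (algebraMap k A)
  have : IsScalarTower k A Z := ⟨fun c a z => by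
    change _ = algebraMap k A c • a • z
    rw [Algebra.smul_def, mul_smul]⟩
  have : SMulCommClass A k Z := ⟨fun a c z => by
    change a • algebraMap k A c • z = algebraMap k A c • a • z
    rw [← mul_smul, ← mul_smul, Algebra.commutes]⟩
  let : Module k Z' := Module.compHom Z' (algebraMap k A)
  have : IsScalarTower k A Z' := ⟨fun c a z => by
    change _ = algebraMap k A c • a • z
    rw [Algebra.smul_def, mul_smul]⟩
  have : SMulCommClass A k Z' := ⟨fun a c z => by
    change a • algebraMap k A c • z = algebraMap k A c • a • z
    rw [← mul_smul, ← mul_smul, Algebra.commutes]⟩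
  obtain ⟨n, p, θ, hp⟩ := exists_dual_basis A P
  let l : (P →ₗ[A] Z) →ₗ[k] k :=
    { toFun := fun u => ∑ j, h (u (p j)) (θ j)
      map_add' := fun u v => by simp [Finset.sum_add_distrib]
      map_smul' := fun c u => by
        rw [RingHom.id_apply, smul_eq_mul, Finset.mul_sum]
        refine Finset.sum_congr rfl fun j _ => ?_
        have : (c • u) (p j) = algebraMap k A c • u (p j) := rfl
        rw [this, map_smul]
        change h (u (p j)) (op (algebraMap k A c) • θ j) = _
        have : op (algebraMap k A c) • θ j = c • θ j := by
          ext x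
          simp [Algebra.smul_def, Algebra.commutes]
        rw [this, map_smul, smul_eq_mul] }
  let I : (P →ₗ[A] Z) →ₗ[k] (P →ₗ[A] Z') :=
    { toFun := fun u => i ∘ₗ u
      map_add' := fun u v => LinearMap.comp_add _ _ _
      map_smul' := fun c u => by
        ext x
        exact map_smul i (algebraMap k A c) (u x) }
  have hI : LinearMap.ker I = ⊥ := by
    refine LinearMap.ker_eq_bot'.mpr fun u hu => LinearMap.ext fun x => hi ?_
    exact (LinearMap.congr_fun hu x).trans (map_zero i).symm
  obtain ⟨r, hr⟩ := LinearMap.exists_leftInverse_of_injective I hI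
  refine ⟨nakayamaLift P Z' (l ∘ₗ r), fun z => LinearMap.ext fun t => ?_⟩
  have : LinearMap.toSpanSingleton A Z' (i z) ∘ₗ t
      = I (LinearMap.toSpanSingleton A Z z ∘ₗ t) := by
    ext x
    exact (map_smul i (t x) z).symm
  rw [nakayamaLift_apply, this, LinearMap.comp_apply]
  have hz := LinearMap.congr_fun hr (LinearMap.toSpanSingleton A Z z ∘ₗ t)
  rw [LinearMap.comp_apply] at hz
  rw [hz, nakayama_expand hp]
  rfl

theorem finite_nakayama [FiniteDimensional k A] :
    Module.Finite A ((P →ₗ[A] A) →ₗ[k] k) := by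
  obtain ⟨n, p, θ, hp⟩ := exists_dual_basis A P
  have : Module.Finite k (P →ₗ[A] A) := by
    let ev : (P →ₗ[A] A) →ₗ[k] (Fin n → A) :=
      { toFun := fun t i => t (p i)
        map_add' := fun _ _ => rfl
        map_smul' := fun _ _ => rfl }
    refine Module.Finite.of_injective ev fun t t' h => ?_
    ext x
    rw [← hp x, map_sum, map_sum]
    refine Finset.sum_congr rfl fun i _ => ?_
    rw [map_smul, map_smul, show t (p i) = t' (p i) from congr_fun h i]
  have : IsScalarTower k A ((P →ₗ[A] A) →ₗ[k] k) := ⟨fun c a f => by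
    ext t
    change f (op (c • a) • t) = c • f (op a • t)
    rw [← map_smul]
    congr 1
    ext x
    simp⟩
  exact Module.Finite.of_restrictScalars_finite k A _

end

theorem inAdd_of_fintype {X Y : ModuleCat.{u} A} {ι : Type*} [Fintype ι]
    (f : Y →ₗ[A] (ι → X)) (g : (ι → X) →ₗ[A] Y) (h : g ∘ₗ f = LinearMap.id) :
    InAdd A X Y := by
  let e := Fintype.equivFin ι
  refine ⟨Fintype.card ι, LinearMap.funLeft A X e.symm ∘ₗ f, g ∘ₗ LinearMap.funLeft A X e, ?_⟩
  ext y
  have : LinearMap.funLeft A X e (LinearMap.funLeft A X e.symm (f y)) = f y := by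
    ext i
    simp [LinearMap.funLeft]
  simp only [LinearMap.comp_apply, this]
  exact LinearMap.congr_fun h y

theorem inAdd_of_hasHom [FiniteDimensional k A] {P X : ModuleCat.{u} A} [Module.Finite A X]
    [Module.Projective A X] [Module.Projective A P]
    (h : ∀ Z : ModuleCat.{u} A, HasHom X Z → HasHom P Z) : InAdd A P X := by
  have : IsNoetherianRing A := isNoetherian_of_tower k inferInstance
  have htop : (⨆ f : P →ₗ[A] X, LinearMap.range f) = ⊤ := by
    by_contra hne
    set T : Submodule A X := ⨆ f : P →ₗ[A] X, LinearMap.range f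
    obtain ⟨f, hf⟩ := h (ModuleCat.of A (X ⧸ T)) ⟨T.mkQ, fun h0 => hne (by
      rw [← T.ker_mkQ]
      exact LinearMap.ker_eq_top.mpr h0)⟩
    obtain ⟨g, hg⟩ := Module.projective_lifting_property T.mkQ f T.mkQ_surjective
    refine hf ?_
    rw [← hg]
    ext x
    exact (Submodule.Quotient.mk_eq_zero T).mpr
      ((le_iSup (fun f : P →ₗ[A] X => LinearMap.range f) g) ⟨x, rfl⟩)
  obtain ⟨s, hs⟩ := Finset.exists_sup_eq_iSup (fun f : P →ₗ[A] X => LinearMap.range f)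
  let g : (s → P) →ₗ[A] X := ∑ i : s, i.1 ∘ₗ LinearMap.proj i
  have hg : Function.Surjective g := by
    classical
    rw [← LinearMap.range_eq_top, eq_top_iff, ← htop, ← hs]
    refine Finset.sup_le fun f hf => ?_
    rintro _ ⟨p, rfl⟩
    refine ⟨Pi.single ⟨f, hf⟩ p, ?_⟩
    simp only [g, LinearMap.sum_apply, LinearMap.comp_apply, LinearMap.proj_apply]
    rw [Finset.sum_eq_single ⟨f, hf⟩]
    · simp
    · intro b _ hb
      simp [Pi.single_eq_of_ne hb]
    · simp
  obtain ⟨f, hf⟩ := Module.projective_lifting_property g LinearMap.id hg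
  exact inAdd_of_fintype f g hf

theorem inAdd_of_hasHom_left [FiniteDimensional k A] {Q V : ModuleCat.{u} A}
    [Module.Finite A V] (hV : Module.Injective A V) (hQ : Module.Injective A Q)
    (h : ∀ Z : ModuleCat.{u} A, HasHom Z V → HasHom Z Q) : InAdd A Q V := by
  have : IsArtinianRing A := isArtinian_of_tower k inferInstance
  have hbot : (⨅ f : V →ₗ[A] Q, LinearMap.ker f) = ⊥ := by
    by_contra hne
    set K : Submodule A V := ⨅ f : V →ₗ[A] Q, LinearMap.ker f
    obtain ⟨f, hf⟩ := h (ModuleCat.of A K) ⟨K.subtype, fun h0 => hne (by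
      rw [← K.range_subtype]
      exact LinearMap.range_eq_bot.mpr h0)⟩
    obtain ⟨g, hg⟩ := hQ.out K.subtype K.subtype_injective f
    refine hf (LinearMap.ext fun x => ?_)
    rw [← hg]
    exact (iInf_le (fun f : V →ₗ[A] Q => LinearMap.ker f) g) x.2
  obtain ⟨s, hs⟩ := Finset.exists_inf_eq_iInf (fun f : V →ₗ[A] Q => LinearMap.ker f)
  let g : V →ₗ[A] (s → Q) := LinearMap.pi fun i => i.1
  have hg : Function.Injective g := by
    rw [← LinearMap.ker_eq_bot, eq_bot_iff, ← hbot, ← hs]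
    intro x hx
    rw [Finset.inf_eq_iInf]
    simp only [Submodule.mem_iInf]
    intro f hf
    exact congr_fun (LinearMap.mem_ker.mp hx) ⟨f, hf⟩
  obtain ⟨f, hf⟩ := hV.out g hg LinearMap.id
  exact inAdd_of_fintype g f (LinearMap.ext hf)

theorem HasHom.of_inAdd_left {P X Z : ModuleCat.{u} A} (h : InAdd A P X) (hX : HasHom X Z) :
    HasHom P Z := by
  classical
  obtain ⟨n, f, g, hfg⟩ := h
  obtain ⟨u, hu⟩ := hX
  by_contra h0
  refine hu ?_
  have : u ∘ₗ g = 0 := by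
    refine LinearMap.pi_ext' fun i => ?_
    by_contra hi
    exact h0 ⟨_, hi⟩
  rw [← LinearMap.comp_id u, ← hfg, ← LinearMap.comp_assoc, this, LinearMap.zero_comp]

theorem HasHom.of_inAdd_right {Q V Z : ModuleCat.{u} A} (h : InAdd A Q V) (hV : HasHom Z V) :
    HasHom Z Q := by
  obtain ⟨n, f, g, hfg⟩ := h
  obtain ⟨u, hu⟩ := hV
  by_contra h0
  refine hu ?_
  have : f ∘ₗ u = 0 := by
    refine LinearMap.ext fun z => funext fun i => ?_
    by_contra hi
    exact h0 ⟨LinearMap.proj i ∘ₗ f ∘ₗ u, fun h => hi (LinearMap.congr_fun h z)⟩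
  rw [← LinearMap.id_comp u, ← hfg, LinearMap.comp_assoc, this, LinearMap.comp_zero]

theorem injective_of_inAdd {Q V : ModuleCat.{u} A} (h : InAdd A Q V)
    (hQ : Module.Injective A Q) : Module.Injective A V := by
  obtain ⟨n, f, g, hfg⟩ := h
  refine ⟨fun Z Z' _ _ _ _ i hi u => ?_⟩
  choose v hv using fun j => hQ.out i hi (LinearMap.proj j ∘ₗ f ∘ₗ u)
  refine ⟨g ∘ₗ LinearMap.pi v, fun z => ?_⟩
  have : LinearMap.pi v (i z) = f (u z) := funext fun j => hv j z
  rw [LinearMap.comp_apply, this]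
  exact LinearMap.congr_fun hfg (u z)

theorem inAdd_refl (X : ModuleCat.{u} A) : InAdd A X X :=
  inAdd_of_fintype (ι := Unit) (LinearMap.pi fun _ => LinearMap.id) (LinearMap.proj ()) rfl

theorem hasHom_nak_iff (P Z : ModuleCat.{u} A) [Module.Finite A P] [Module.Projective A P] :
    HasHom Z (nak k A P) ↔ HasHom P Z :=
  ⟨exists_hom_of_exists_hom_nakayama P Z, exists_hom_nakayama_of_exists_hom P Z⟩

theorem injective_nak (P : ModuleCat.{u} A) [Module.Finite A P] [Module.Projective A P] :
    Module.Injective A (nak k A P) :=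
  injective_nakayama P

theorem finite_nak [FiniteDimensional k A] (P : ModuleCat.{u} A) [Module.Finite A P]
    [Module.Projective A P] : Module.Finite A (nak k A P) :=
  finite_nakayama P

theorem inAdd_nak_iff [FiniteDimensional k A] (P Q : ModuleCat.{u} A) [Module.Finite A P]
    [Module.Projective A P] [Module.Finite A Q] [Module.Projective A Q] :
    InAdd A (nak k A Q) (nak k A P) ↔ InAdd A Q P := by
  constructor
  · refine fun h => inAdd_of_hasHom (k := k) fun Z hZ => ?_
    rw [← hasHom_nak_iff (k := k)] at hZ ⊢
    exact hZ.of_inAdd_right h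
  · intro h
    have := finite_nak (k := k) P
    refine inAdd_of_hasHom_left (k := k) (injective_nak P) (injective_nak Q) fun Z hZ => ?_
    rw [hasHom_nak_iff] at hZ ⊢
    exact hZ.of_inAdd_left h

/-- The trace ideal of `P` in `A`. -/
def traceIdeal (P : ModuleCat.{u} A) : Submodule A A := ⨆ f : P →ₗ[A] A, LinearMap.range f

theorem traceIdeal_le_of_inAdd {P X : ModuleCat.{u} A} (h : InAdd A P X) :
    traceIdeal X ≤ traceIdeal P := by
  classical
  obtain ⟨n, f, g, hfg⟩ := h
  refine iSup_le fun t => ?_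
  rintro _ ⟨x, rfl⟩
  rw [← LinearMap.id_apply (R := A) x, ← hfg, LinearMap.comp_apply,
    ← Finset.univ_sum_single (f x), map_sum, map_sum]
  refine Submodule.sum_mem _ fun i _ => ?_
  exact (le_iSup (fun f : P →ₗ[A] A => LinearMap.range f)
    (t ∘ₗ g ∘ₗ LinearMap.single A (fun _ => P) i)) ⟨f x i, rfl⟩

theorem HasHom.of_traceIdeal_le {P X Z : ModuleCat.{u} A} [Module.Finite A X]
    [Module.Projective A X] (h : traceIdeal X ≤ traceIdeal P) (hX : HasHom X Z) :
    HasHom P Z := by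
  obtain ⟨u, hu⟩ := hX
  obtain ⟨n, p, θ, hp⟩ := exists_dual_basis A X
  by_contra h0
  refine hu (LinearMap.ext fun x => ?_)
  rw [← hp x, map_sum]
  refine Finset.sum_eq_zero fun i _ => ?_
  rw [map_smul]
  have hle : traceIdeal P ≤ LinearMap.ker (LinearMap.toSpanSingleton A Z (u (p i))) := by
    refine iSup_le fun t => ?_
    rintro _ ⟨y, rfl⟩
    by_contra hy
    exact h0 ⟨LinearMap.toSpanSingleton A Z (u (p i)) ∘ₗ t,
      fun h => hy (LinearMap.congr_fun h y)⟩
  exact hle (h ((le_iSup (fun f : X →ₗ[A] A => LinearMap.range f) (θ i)) ⟨x, rfl⟩))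

theorem IsStp.nak [FiniteDimensional k A] {X : ModuleCat.{u} A} (h : IsStp k A X) :
    IsStp k A (nak k A X) := by
  obtain ⟨h1, h2, h3⟩ := h
  exact ⟨finite_nak X, h3 1 one_pos, fun i hi => h3 (i + 1) (Nat.succ_pos i)⟩

theorem inAdd_nak_self [FiniteDimensional k A] {X : ModuleCat.{u} A} (hX : IsStp k A X)
    (h : InAdd A X (_root_.nak k A X)) : InAdd A (_root_.nak k A X) X := by
  have : IsArtinianRing A := isArtinian_of_tower k inferInstance
  let P : ℕ → ModuleCat.{u} A := fun i => (_root_.nak k A)^[i] X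
  have hsucc (i) : P (i + 1) = _root_.nak k A (P i) := Function.iterate_succ_apply' _ _ _
  have hstp (i) : IsStp k A (P i) := by
    induction i with
    | zero => exact hX
    | succ i ih => rw [hsucc]; exact ih.nak
  have hfin (i) : Module.Finite A (P i) := (hstp i).1
  have hproj (i) : Module.Projective A (P i) := (hstp i).2.1
  have hdesc (i) : InAdd A (P i) (P (i + 1)) := by
    induction i with
    | zero => exact h
    | succ i ih =>
      rw [hsucc (i + 1)]
      nth_rw 1 [hsucc i]
      exact (inAdd_nak_iff _ _).mpr ih
  obtain ⟨n, hn⟩ := IsArtinian.monotone_stabilizes (R := A) (M := A)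
    ⟨fun i => OrderDual.toDual (traceIdeal (P i)),
      monotone_nat_of_le_succ fun i => traceIdeal_le_of_inAdd (hdesc i)⟩
  have hasc : InAdd A (P (n + 1)) (P n) :=
    inAdd_of_hasHom (k := k) fun Z hZ =>
      hZ.of_traceIdeal_le (le_of_eq (hn (n + 1) n.le_succ) : traceIdeal (P n) ≤ traceIdeal _)
  clear hn
  induction n with
  | zero => exact hasc
  | succ n ih =>
    refine ih ((inAdd_nak_iff (k := k) _ _).mp ?_)
    rw [← hsucc, ← hsucc]
    exact hasc

/-- A projective and injective module such that every module receiving a nonzero map from it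
also maps nontrivially to it. -/
structure IsSelfDual (Q : ModuleCat.{u} A) : Prop where
  finite : Module.Finite A Q
  projective : Module.Projective A Q
  injective : Module.Injective A Q
  hasHom : ∀ Z : ModuleCat.{u} A, HasHom Q Z → HasHom Z Q

theorem IsSelfDual.isStp [FiniteDimensional k A] {Q : ModuleCat.{u} A} (hQ : IsSelfDual Q) :
    IsStp k A Q := by
  have := hQ.finite
  have := hQ.projective
  have key (i : ℕ) : Module.Finite A ((nak k A)^[i] Q) ∧ InAdd A Q ((nak k A)^[i] Q) ∧
      Module.Projective A ((nak k A)^[i] Q) := by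
    induction i with
    | zero => exact ⟨hQ.finite, inAdd_refl Q, hQ.projective⟩
    | succ i ih =>
      obtain ⟨h1, h2, h3⟩ := ih
      rw [Function.iterate_succ_apply']
      have := finite_nak (k := k) ((nak k A)^[i] Q)
      have hadd : InAdd A Q (nak k A ((nak k A)^[i] Q)) := by
        refine inAdd_of_hasHom_left (k := k) (injective_nak _) hQ.injective fun Z hZ => ?_
        rw [hasHom_nak_iff] at hZ
        exact hQ.hasHom Z (hZ.of_inAdd_left h2)
      refine ⟨inferInstance, hadd, ?_⟩
      obtain ⟨n, f, g, hfg⟩ := hadd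
      have : Module.Projective A (Fin n → Q) :=
        Module.Projective.of_equiv
          (DFinsupp.linearEquivFunOnFintype (R := A) (M := fun _ : Fin n => Q))
      exact Module.Projective.of_split f g hfg
  exact ⟨hQ.finite, hQ.projective, fun i _ => (key i).2.2⟩

theorem isSelfDual_of_inAdd_iff_isStp [FiniteDimensional k A] {X : ModuleCat.{u} A}
    (hX : ∀ V : ModuleCat.{u} A, InAdd A X V ↔ IsStp k A V) :
    IsSelfDual X ∧ ∀ Z : ModuleCat.{u} A, HasHom Z X → HasHom X Z := by
  have hs : IsStp k A X := (hX X).mp (inAdd_refl X)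
  have := hs.1
  have := hs.2.1
  have h1 : InAdd A X (nak k A X) := (hX _).mpr hs.nak
  have h2 := inAdd_nak_self hs h1
  exact ⟨⟨hs.1, hs.2.1, injective_of_inAdd h2 (injective_nak X), fun Z hZ =>
    ((hasHom_nak_iff (k := k) X Z).mpr hZ).of_inAdd_right h1⟩,
    fun Z hZ => (hasHom_nak_iff (k := k) X Z).mp (hZ.of_inAdd_right h2)⟩

end StablyProjective

section FrobeniusExtension

theorem isFrobeniusRingHom_of_trace {Γ Λ : Type u} [Ring Γ] [Ring Λ] (ι : Γ →+* Λ)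
    (tr : Λ →+ Γ) (h₁ : ∀ γ x, tr (ι γ * x) = γ * tr x) (h₂ : ∀ γ x, tr (x * ι γ) = tr x * γ)
    {n : ℕ} (l r : Fin n → Λ) (hl : ∀ y, ∑ i, ι (tr (y * r i)) * l i = y)
    (hr : ∀ y, ∑ i, r i * ι (tr (l i * y)) = y) : IsFrobeniusRingHom ι := by
  let : Module Γ Λ := Module.compHom Λ ι
  have hsmul (γ : Γ) (x : Λ) : γ • x = ι γ * x := rfl
  let c : Λ →ₗ[Γ] (Fin n → Γ) :=
    { toFun := fun y i => tr (y * r i)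
      map_add' := fun x y => by ext i; simp [add_mul]
      map_smul' := fun γ x => by ext i; simp [hsmul, mul_assoc, h₁] }
  let d : (Fin n → Γ) →ₗ[Γ] Λ :=
    { toFun := fun v => ∑ i, v i • l i
      map_add' := fun x y => by simp [add_smul, Finset.sum_add_distrib]
      map_smul' := fun γ x => by simp [Finset.smul_sum, mul_smul] }
  have hdc : d ∘ₗ c = LinearMap.id := LinearMap.ext hl
  refine ⟨Module.Finite.of_surjective d fun y => ⟨c y, LinearMap.congr_fun hdc y⟩,
    Module.Projective.of_split c d hdc, ?_⟩
  let e : Λ →+ (Λ →ₗ[Γ] Γ) :=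
    { toFun := fun x =>
        { toFun := fun y => tr (y * x)
          map_add' := fun y z => by simp [add_mul]
          map_smul' := fun γ y => by simp [hsmul, mul_assoc, h₁] }
      map_zero' := by ext y; simp
      map_add' := fun x x' => by ext y; simp [mul_add] }
  have he (x y) : e x y = tr (y * x) := rfl
  have hbij : Function.Bijective e := by
    constructor
    · rw [injective_iff_map_eq_zero]
      intro x hx
      rw [← hr x]
      refine Finset.sum_eq_zero fun i _ => ?_
      rw [← he, hx]
      simp
    · intro t
      refine ⟨∑ i, r i * ι (t (l i)), LinearMap.ext fun y => ?_⟩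
      rw [he]
      conv_rhs => rw [← hl y, map_sum]
      rw [Finset.mul_sum, map_sum]
      refine Finset.sum_congr rfl fun i _ => ?_
      rw [← mul_assoc, h₂, ← hsmul, map_smul, smul_eq_mul]
  refine ⟨AddEquiv.ofBijective e hbij, fun l x y => ?_, fun γ x y => ?_⟩
  · change tr _ = tr _
    rw [mul_assoc]
  · change tr _ = tr _ * γ
    rw [← mul_assoc, h₂]

theorem isFrobeniusRingHom_of_unit_counit {A X T Λ : Type u} [Ring A] [AddCommGroup X]
    [Module A X] [AddCommGroup T] [Module A T] [Ring Λ] (Φ : Module.End A X →+* Λ)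
    (G : Λ →+* Module.End A T) (η : X →ₗ[A] T) (ε : T →ₗ[A] X)
    (hη : ∀ f, G (Φ f) ∘ₗ η = η ∘ₗ f) (hε : ∀ f, ε ∘ₗ G (Φ f) = f ∘ₗ ε)
    (hα : Function.Bijective fun l => G l ∘ₗ η) (hβ : Function.Bijective fun l => ε ∘ₗ G l)
    {n : ℕ} (f : T →ₗ[A] (Fin n → X)) (g : (Fin n → X) →ₗ[A] T) (hgf : g ∘ₗ f = LinearMap.id)
    (r : T →ₗ[A] X) (hr : r ∘ₗ η = LinearMap.id)
    (s : X →ₗ[A] T) (hs : ε ∘ₗ s = LinearMap.id) :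
    Function.Injective Φ ∧ IsFrobeniusRingHom Φ ∧ IsLeftSplitRingHom Φ ∧
      IsRightSplitRingHom Φ := by
  classical
  have hleft : IsLeftSplitRingHom Φ := by
    refine ⟨⟨⟨fun l => ε ∘ₗ G l ∘ₗ s, by simp⟩, fun x y => ?_⟩, fun γ x => ?_, fun γ => ?_⟩
    · simp [LinearMap.add_comp, LinearMap.comp_add]
    · change ε ∘ₗ G (Φ γ * x) ∘ₗ s = γ ∘ₗ ε ∘ₗ G x ∘ₗ s
      rw [map_mul, Module.End.mul_eq_comp, ← LinearMap.comp_assoc, ← LinearMap.comp_assoc, hε]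
      rfl
    · change ε ∘ₗ G (Φ γ) ∘ₗ s = γ
      rw [← LinearMap.comp_assoc, hε, LinearMap.comp_assoc, hs, LinearMap.comp_id]
  have hright : IsRightSplitRingHom Φ := by
    refine ⟨⟨⟨fun l => r ∘ₗ G l ∘ₗ η, by simp⟩, fun x y => ?_⟩, fun γ x => ?_, fun γ => ?_⟩
    · simp [LinearMap.add_comp, LinearMap.comp_add]
    · change r ∘ₗ G (x * Φ γ) ∘ₗ η = (r ∘ₗ G x ∘ₗ η) ∘ₗ γ
      rw [map_mul, Module.End.mul_eq_comp, LinearMap.comp_assoc η, hη]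
      rfl
    · change r ∘ₗ G (Φ γ) ∘ₗ η = γ
      rw [hη, ← LinearMap.comp_assoc, hr, LinearMap.id_comp]
  refine ⟨?_, ?_, hleft, hright⟩
  · obtain ⟨π, -, hπ⟩ := hleft
    exact Function.LeftInverse.injective hπ
  choose r' hr' using fun i => hα.2 (g ∘ₗ LinearMap.single A (fun _ => X) i)
  choose l' hl' using fun i => hβ.2 (LinearMap.proj i ∘ₗ f)
  have hsum : ∑ i, (g ∘ₗ LinearMap.single A (fun _ => X) i) ∘ₗ (LinearMap.proj i ∘ₗ f)
      = LinearMap.id := by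
    rw [← hgf]
    ext t
    simp only [LinearMap.sum_apply, LinearMap.comp_apply, LinearMap.proj_apply,
      LinearMap.single_apply]
    rw [← map_sum, Finset.univ_sum_single]
  simp only at hr' hl'
  let tr : Λ →+ Module.End A X :=
    ⟨⟨fun l => ε ∘ₗ G l ∘ₗ η, by simp⟩,
      fun x y => by simp [LinearMap.add_comp, LinearMap.comp_add]⟩
  have htr (l) : tr l = ε ∘ₗ G l ∘ₗ η := rfl
  have hmul (x y) : G (x * y) = G x ∘ₗ G y := map_mul G x y
  refine isFrobeniusRingHom_of_trace Φ tr (fun γ x => ?_) (fun γ x => ?_) l' r'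
    (fun y => hβ.1 ?_) fun y => hα.1 ?_
  · rw [htr, hmul, ← LinearMap.comp_assoc, ← LinearMap.comp_assoc, hε]
    rfl
  · rw [htr, hmul, LinearMap.comp_assoc η, hη]
    rfl
  · have key (i) : ε ∘ₗ G (Φ (tr (y * r' i)) * l' i) = (ε ∘ₗ G y) ∘ₗ
        (g ∘ₗ LinearMap.single A (fun _ => X) i) ∘ₗ (LinearMap.proj i ∘ₗ f) := by
      rw [hmul, ← LinearMap.comp_assoc, hε, LinearMap.comp_assoc, hl', htr, hmul,
        LinearMap.comp_assoc η, hr']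
      rfl
    ext t
    simp only [map_sum, LinearMap.comp_apply, LinearMap.sum_apply]
    conv_rhs => rw [← LinearMap.id_apply (R := A) t, ← hsum, LinearMap.sum_apply, map_sum, map_sum]
    exact Finset.sum_congr rfl fun i _ => LinearMap.congr_fun (key i) t
  · have key (i) : G (r' i * Φ (tr (l' i * y))) ∘ₗ η =
        ((g ∘ₗ LinearMap.single A (fun _ => X) i) ∘ₗ (LinearMap.proj i ∘ₗ f)) ∘ₗ G y ∘ₗ η := by
      rw [hmul, LinearMap.comp_assoc, hη, ← LinearMap.comp_assoc, hr', htr, hmul,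
        LinearMap.comp_assoc η, ← LinearMap.comp_assoc _ _ ε, hl']
      rfl
    ext t
    simp only [map_sum, LinearMap.comp_apply, LinearMap.sum_apply]
    conv_rhs => rw [← LinearMap.id_apply (R := A) (G y (η t)), ← hsum, LinearMap.sum_apply]
    exact Finset.sum_congr rfl fun i _ => LinearMap.congr_fun (key i) t

end FrobeniusExtension

section Adjunction

open CategoryTheory

variable {A B : Type u} [Ring A] [Ring B] {F : ModuleCat.{u} A ⥤ ModuleCat.{u} B}
  {G : ModuleCat.{u} B ⥤ ModuleCat.{u} A}

theorem IsSelfDual.map {Q : ModuleCat.{u} A} (hQ : IsSelfDual Q) (adj₁ : F ⊣ G) (adj₂ : G ⊣ F)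
    [G.PreservesZeroMorphisms] [F.PreservesZeroMorphisms]
    (hfin : Module.Finite B (F.obj Q)) : IsSelfDual (F.obj Q) := by
  have := adj₁.isLeftAdjoint
  have := adj₂.isLeftAdjoint
  have := adj₁.isRightAdjoint
  refine ⟨hfin, ?_, ?_, ?_⟩
  · rw [IsProjective.iff_projective]
    exact adj₁.map_projective Q ((IsProjective.iff_projective Q).mp hQ.projective)
  · rw [Module.injective_iff_injective_object]
    exact adj₂.map_injective Q ((Module.injective_iff_injective_object A Q).mp hQ.injective)
  · rintro Z ⟨f, hf⟩
    obtain ⟨g, hg⟩ := hQ.hasHom (G.obj Z) ⟨(adj₁.homEquiv Q Z (ModuleCat.ofHom f)).hom, fun h =>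
      hf <| by
        have h' : adj₁.homEquiv Q Z (ModuleCat.ofHom f) = 0 := ModuleCat.hom_ext h
        have h0 : adj₁.homEquiv Q Z 0 = 0 := by simp [adj₁.homEquiv_unit]
        exact congrArg ModuleCat.Hom.hom ((adj₁.homEquiv Q Z).injective (h'.trans h0.symm))⟩
    refine ⟨(adj₂.homEquiv Z Q (ModuleCat.ofHom g)).hom, fun h => hg ?_⟩
    have h' : adj₂.homEquiv Z Q (ModuleCat.ofHom g) = 0 := ModuleCat.hom_ext h
    have h0 : adj₂.homEquiv Z Q 0 = 0 := by simp [adj₂.homEquiv_unit]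
    exact congrArg ModuleCat.Hom.hom ((adj₂.homEquiv Z Q).injective (h'.trans h0.symm))

theorem exists_retraction_unit {X : ModuleCat.{u} A} (hinj : Module.Injective A X)
    (hX : ∀ Z : ModuleCat.{u} A, HasHom Z X → HasHom X Z) (adj : F ⊣ G)
    [G.PreservesZeroMorphisms] (hF : ∀ w : X ⟶ X, F.map w = 0 → w = 0) :
    ∃ r : G.obj (F.obj X) →ₗ[A] X, r ∘ₗ (adj.unit.app X).hom = LinearMap.id := by
  have hη : Function.Injective (adj.unit.app X).hom := by
    rw [← LinearMap.ker_eq_bot]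
    by_contra hne
    set K : Submodule A X := LinearMap.ker (adj.unit.app X).hom
    obtain ⟨f, hf⟩ := hX (ModuleCat.of A K) ⟨K.subtype, fun h0 => hne (by
      rw [← K.range_subtype]
      exact LinearMap.range_eq_bot.mpr h0)⟩
    refine hf ?_
    let w : X ⟶ X := ModuleCat.ofHom (K.subtype ∘ₗ f)
    have hw : w = 0 := by
      refine hF w ((adj.homEquiv X _).injective ?_)
      rw [adj.homEquiv_unit, adj.homEquiv_unit, Functor.map_zero, Limits.comp_zero,
        adj.unit_naturality w]
      ext x
      exact (f x).2
    ext x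
    exact LinearMap.congr_fun (congrArg ModuleCat.Hom.hom hw) x
  obtain ⟨r, hr⟩ := hinj.out _ hη LinearMap.id
  exact ⟨r, LinearMap.ext hr⟩

theorem exists_section_counit {X : ModuleCat.{u} A} (hX : IsSelfDual X) (adj : G ⊣ F)
    [G.PreservesZeroMorphisms] (hF : ∀ w : X ⟶ X, F.map w = 0 → w = 0) :
    ∃ s : X →ₗ[A] G.obj (F.obj X), (adj.counit.app X).hom ∘ₗ s = LinearMap.id := by
  have := hX.projective
  refine Module.projective_lifting_property _ _ ?_
  rw [← LinearMap.range_eq_top]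
  by_contra hne
  set T := LinearMap.range (adj.counit.app X).hom
  obtain ⟨f, hf⟩ := hX.hasHom (ModuleCat.of A (X ⧸ T)) ⟨T.mkQ, fun h0 => hne (by
    rw [← T.ker_mkQ]
    exact LinearMap.ker_eq_top.mpr h0)⟩
  refine hf ?_
  have hw : ModuleCat.ofHom (f ∘ₗ T.mkQ) = 0 := by
    refine hF _ ((adj.homEquiv _ X).symm.injective ?_)
    rw [adj.homEquiv_counit, adj.homEquiv_counit, Functor.map_zero, Limits.zero_comp,
      adj.counit_naturality]
    ext x
    have : T.mkQ ((adj.counit.app X).hom x) = 0 := (Submodule.Quotient.mk_eq_zero T).mpr ⟨x, rfl⟩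
    change f (T.mkQ ((adj.counit.app X).hom x)) = 0
    rw [this, map_zero]
  refine LinearMap.ext fun x => ?_
  obtain ⟨x, rfl⟩ := T.mkQ_surjective x
  exact LinearMap.congr_fun (congrArg ModuleCat.Hom.hom hw) x

/-- The ring homomorphism on endomorphisms induced by an additive functor. -/
def endMap (F : ModuleCat.{u} A ⥤ ModuleCat.{u} B) [F.Additive] (X : ModuleCat.{u} A) :
    Module.End A X →+* Module.End B (F.obj X) where
  toFun f := (F.map (ModuleCat.ofHom f)).hom
  map_one' := congrArg ModuleCat.Hom.hom (F.map_id X)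
  map_mul' f g := congrArg ModuleCat.Hom.hom (F.map_comp (ModuleCat.ofHom g) (ModuleCat.ofHom f))
  map_zero' := congrArg ModuleCat.Hom.hom (F.map_zero X X)
  map_add' f g := congrArg ModuleCat.Hom.hom
    (F.map_add (f := ModuleCat.ofHom f) (g := ModuleCat.ofHom g))

theorem isFrobeniusRingHom_endMap [F.Additive] [G.Additive] {k : Type u} [Field k] [Algebra k A]
    [FiniteDimensional k A] (adj₁ : F ⊣ G) (adj₂ : G ⊣ F) {X : ModuleCat.{u} A}
    (hX : ∀ V : ModuleCat.{u} A, InAdd A X V ↔ IsStp k A V)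
    (hfin : Module.Finite B (F.obj X)) (hfin' : Module.Finite A (G.obj (F.obj X)))
    (hF : ∀ w : X ⟶ X, F.map w = 0 → w = 0) :
    Function.Injective (endMap F X) ∧ IsFrobeniusRingHom (endMap F X) ∧
      IsLeftSplitRingHom (endMap F X) ∧ IsRightSplitRingHom (endMap F X) := by
  obtain ⟨hsd, hconv⟩ := isSelfDual_of_inAdd_iff_isStp hX
  obtain ⟨n, f, g, hgf⟩ := (hX _).mpr ((hsd.map adj₁ adj₂ hfin).map adj₂ adj₁ hfin').isStp
  obtain ⟨r, hr⟩ := exists_retraction_unit hsd.injective hconv adj₁ hF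
  obtain ⟨s, hs⟩ := exists_section_counit hsd adj₂ hF
  refine isFrobeniusRingHom_of_unit_counit (endMap F X) (endMap G (F.obj X))
    (adj₁.unit.app X).hom (adj₂.counit.app X).hom (fun f => ?_) (fun f => ?_) ?_ ?_
    f g hgf r hr s hs
  · exact congrArg ModuleCat.Hom.hom (adj₁.unit_naturality (ModuleCat.ofHom f))
  · exact congrArg ModuleCat.Hom.hom (adj₂.counit_naturality (ModuleCat.ofHom f))
  · have h : (fun l => endMap G (F.obj X) l ∘ₗ (adj₁.unit.app X).hom) =
        ModuleCat.homEquiv ∘ adj₁.homEquiv X (F.obj X) ∘ ModuleCat.homEquiv.symm := by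
      ext l x
      simp [adj₁.homEquiv_unit, endMap, ModuleCat.homEquiv]
    rw [h]
    exact ModuleCat.homEquiv.bijective.comp
      ((adj₁.homEquiv _ _).bijective.comp ModuleCat.homEquiv.symm.bijective)
  · have h : (fun l => (adj₂.counit.app X).hom ∘ₗ endMap G (F.obj X) l) =
        ModuleCat.homEquiv ∘ (adj₂.homEquiv (F.obj X) X).symm ∘ ModuleCat.homEquiv.symm := by
      ext l x
      simp [adj₂.homEquiv_counit, endMap, ModuleCat.homEquiv]
    rw [h]
    exact ModuleCat.homEquiv.bijective.comp
      ((adj₂.homEquiv _ _).symm.bijective.comp ModuleCat.homEquiv.symm.bijective)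

end Adjunction

section BimoduleFunctors

open CategoryTheory

section Tensor

variable {A B M X : Type u} [Ring A] [Ring B] [AddCommGroup M] [Module B M] [Module Aᵐᵒᵖ M]
  [AddCommGroup X] [Module A X]

variable (A B M X) in
/-- The biadditive map `(m, x) ↦ m ⊗ x`. -/
noncomputable def mkTHom : M →+ X →+ NCT A M X B :=
  AddMonoidHom.mk' (fun m => AddMonoidHom.mk' (mkT A M X B m) fun x y =>
      congrArg (Submodule.Quotient.mk (p := balS A M X B)) (TensorProduct.tmul_add m x y))
    fun m m' => AddMonoidHom.ext fun x =>
      congrArg (Submodule.Quotient.mk (p := balS A M X B)) (TensorProduct.add_tmul m m' x)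

theorem mkTHom_apply (m : M) (x : X) : mkTHom A B M X m x = mkT A M X B m x := rfl

theorem smul_mkT (b : B) (m : M) (x : X) : b • mkT A M X B m x = mkT A M X B (b • m) x := rfl

theorem mkT_smul (m : M) (a : A) (x : X) :
    mkT A M X B m (a • x) = mkT A M X B (op a • m) x :=
  (Submodule.Quotient.eq _).mpr (Submodule.subset_span ⟨m, a, x, rfl⟩)

theorem mkT_induction {p : NCT A M X B → Prop} (h : ∀ m x, p (mkT A M X B m x))
    (hadd : ∀ v w, p v → p w → p (v + w)) (w : NCT A M X B) : p w := by
  obtain ⟨w, rfl⟩ := Submodule.Quotient.mk_surjective _ w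
  induction w with
  | zero =>
    have := h 0 0
    rwa [mkT, TensorProduct.zero_tmul] at this
  | tmul m x => exact h m x
  | add v w hv hw => exact hadd _ _ hv hw

variable {W : Type u} [AddCommGroup W]

theorem linearMap_ext_mkT [Module B W] {f g : NCT A M X B →ₗ[B] W}
    (h : ∀ m x, f (mkT A M X B m x) = g (mkT A M X B m x)) : f = g := by
  ext w
  induction w using mkT_induction with
  | h m x => exact h m x
  | hadd v w hv hw => rw [map_add, map_add, hv, hw]

theorem finite_tensor [Module.Finite B M] [Module.Finite A X] :
    Module.Finite B (NCT A M X B) := by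
  classical
  obtain ⟨n, p, hp⟩ := Module.Finite.exists_fin' A X
  let f : (Fin n → M) →ₗ[B] NCT A M X B :=
    { toFun := fun v => ∑ j, mkT A M X B (v j) (p (Pi.single j 1))
      map_add' := fun v w => by simp [← mkTHom_apply, Finset.sum_add_distrib]
      map_smul' := fun b v => by simp [Finset.smul_sum, smul_mkT] }
  refine Module.Finite.of_surjective f fun w => ?_
  induction w using mkT_induction with
  | h m x =>
    obtain ⟨a, rfl⟩ := hp x
    refine ⟨fun j => op (a j) • m, ?_⟩
    change ∑ j, mkT A M X B (op (a j) • m) (p (Pi.single j 1)) = _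
    conv_rhs => rw [pi_eq_sum_univ' a, map_sum, ← mkTHom_apply, map_sum]
    refine Finset.sum_congr rfl fun j _ => ?_
    rw [mkTHom_apply, map_smul, mkT_smul]
  | hadd v w hv hw =>
    obtain ⟨v, rfl⟩ := hv
    obtain ⟨w, rfl⟩ := hw
    exact ⟨v + w, map_add f v w⟩

variable [SMulCommClass Aᵐᵒᵖ B M]

/-- The additive map out of `M ⊗_A X` induced by a balanced biadditive map. -/
noncomputable def liftT (f : M →+ X →+ W) (hf : ∀ m (a : A) x, f (op a • m) x = f m (a • x)) :
    NCT A M X B →+ W :=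
  QuotientAddGroup.lift (balS A M X B).toAddSubgroup
    (TensorProduct.liftAddHom f fun n m x => by simp) fun z hz => by
      have h : ∀ b : B, TensorProduct.liftAddHom f (fun (n : ℤ) m x => by simp) (b • z) = 0 := by
        refine Submodule.span_induction (fun z hz b => ?_) (fun b => by simp)
          (fun y z _ _ hy hz b => ?_) (fun c z _ hz b => ?_) hz
        · obtain ⟨m, a, x, rfl⟩ := hz
          rw [smul_sub, TensorProduct.smul_tmul', TensorProduct.smul_tmul', map_sub,
            TensorProduct.liftAddHom_tmul, TensorProduct.liftAddHom_tmul, ← hf, smul_comm, sub_self]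
        · rw [smul_add, map_add, hy, hz, add_zero]
        · rw [← mul_smul]
          exact hz _
      simpa using h 1

/-- The linear map out of `M ⊗_A X` induced by a balanced biadditive map. -/
noncomputable def liftTLinear [Module B W] (f : M →+ X →+ W)
    (hf : ∀ m (a : A) x, f (op a • m) x = f m (a • x))
    (hb : ∀ (b : B) m x, f (b • m) x = b • f m x) : NCT A M X B →ₗ[B] W where
  toFun := liftT f hf
  map_add' := map_add _
  map_smul' b w := by
    induction w using mkT_induction with
    | h m x => exact hb b m x
    | hadd v w hv hw => rw [smul_add, map_add, map_add, hv, hw, smul_add]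

variable (A B M) in
/-- The map `id_M ⊗ f`. -/
noncomputable def mapT {X' : Type u} [AddCommGroup X'] [Module A X'] (f : X →ₗ[A] X') :
    NCT A M X B →ₗ[B] NCT A M X' B :=
  liftTLinear (AddMonoidHom.mk' (fun m => (mkTHom A B M X' m).comp f.toAddMonoidHom)
      fun m m' => by ext x; simp)
    (fun m a x => by simp [mkTHom_apply, mkT_smul]) fun b m x => rfl

theorem mapT_mkT {X' : Type u} [AddCommGroup X'] [Module A X'] (f : X →ₗ[A] X') (m : M) (x : X) :
    mapT A B M f (mkT A M X B m x) = mkT A M X' B m (f x) := rfl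

end Tensor

variable (A B M : Type u) [Ring A] [Ring B] [AddCommGroup M] [Module B M] [Module Aᵐᵒᵖ M]
  [SMulCommClass Aᵐᵒᵖ B M]

/-- The functor `M ⊗_A -`. -/
noncomputable def tensorFunctor : ModuleCat.{u} A ⥤ ModuleCat.{u} B where
  obj X := ModuleCat.of B (NCT A M X B)
  map f := ModuleCat.ofHom (mapT A B M f.hom)
  map_id _ := ModuleCat.hom_ext (linearMap_ext_mkT fun _ _ => rfl)
  map_comp _ _ := ModuleCat.hom_ext (linearMap_ext_mkT fun _ _ => rfl)

instance : (tensorFunctor A B M).Additive where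
  map_add {_ X' f g} := ModuleCat.hom_ext (linearMap_ext_mkT fun m x =>
    map_add (mkTHom A B M X' m) (f.hom x) (g.hom x))

/-- The map `Hom_B(M, g)`. -/
def homMap {Y Y' : Type u} [AddCommGroup Y] [Module B Y] [AddCommGroup Y'] [Module B Y']
    (g : Y →ₗ[B] Y') : (M →ₗ[B] Y) →ₗ[A] (M →ₗ[B] Y') where
  toFun f := g ∘ₗ f
  map_add' _ _ := LinearMap.comp_add _ _ _
  map_smul' _ _ := rfl

/-- The functor `Hom_B(M, -)`. -/
def homFunctor : ModuleCat.{u} B ⥤ ModuleCat.{u} A where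
  obj Y := ModuleCat.of A (M →ₗ[B] Y)
  map g := ModuleCat.ofHom (homMap A B M g.hom)
  map_id _ := rfl
  map_comp _ _ := rfl

instance : (homFunctor A B M).Additive where
  map_add := rfl

variable {M} in
theorem smul_hom_apply {Y : Type u} [AddCommGroup Y] [Module B Y] (a : A) (f : M →ₗ[B] Y) (m : M) :
    (a • f) m = f (op a • m) := rfl

/-- The unit `x ↦ (m ↦ m ⊗ x)` of the tensor-hom adjunction. -/
noncomputable def tensorUnit (X : Type u) [AddCommGroup X] [Module A X] :
    X →ₗ[A] (M →ₗ[B] NCT A M X B) where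
  toFun x :=
    { toFun := fun m => mkT A M X B m x
      map_add' := fun m m' => by simp [← mkTHom_apply]
      map_smul' := fun b m => (smul_mkT b m x).symm }
  map_add' x x' := LinearMap.ext fun m => map_add (mkTHom A B M X m) x x'
  map_smul' a x := LinearMap.ext fun m => mkT_smul m a x

/-- The counit `m ⊗ f ↦ f m` of the tensor-hom adjunction. -/
noncomputable def tensorCounit (Y : Type u) [AddCommGroup Y] [Module B Y] :
    NCT A M (M →ₗ[B] Y) B →ₗ[B] Y :=
  liftTLinear (AddMonoidHom.mk' (fun m => AddMonoidHom.mk' (fun f => f m) fun _ _ => rfl)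
      fun m m' => by ext f; exact map_add f m m')
    (fun _ _ _ => rfl) fun b m f => map_smul f b m

/-- The tensor-hom adjunction. -/
noncomputable def tensorHomAdjunction : tensorFunctor A B M ⊣ homFunctor A B M :=
  Adjunction.mkOfUnitCounit
    { unit :=
        { app := fun X => ModuleCat.ofHom (Y := M →ₗ[B] NCT A M X B) (tensorUnit A B M X)
          naturality := fun _ _ _ => rfl }
      counit :=
        { app := fun Y => ModuleCat.ofHom (X := NCT A M (M →ₗ[B] Y) B) (tensorCounit A B M Y)
          naturality := fun Y Y' g => by
            have h : tensorCounit A B M Y' ∘ₗ mapT A B M (homMap A B M g.hom) =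
                g.hom ∘ₗ tensorCounit A B M Y := linearMap_ext_mkT fun _ _ => rfl
            exact congrArg ModuleCat.ofHom h }
      left_triangle := by
        ext X : 2
        have h : tensorCounit A B M (NCT A M X B) ∘ₗ mapT A B M (tensorUnit A B M X) =
            LinearMap.id := linearMap_ext_mkT fun _ _ => rfl
        exact congrArg ModuleCat.ofHom h
      right_triangle := rfl }

end BimoduleFunctors

section FrobeniusBimoduleAdjunction

open CategoryTheory

variable (A B M : Type u) [Ring A] [Ring B] [AddCommGroup M] [Module B M] [Module Aᵐᵒᵖ M]
  [SMulCommClass Aᵐᵒᵖ B M]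

/-- A Frobenius bimodule with chosen isomorphism of duals and chosen dual bases. -/
structure FrobeniusData where
  /-- The isomorphism between the left and the right dual. -/
  e : (M →ₗ[B] B) ≃+ (M →ₗ[Aᵐᵒᵖ] A)
  e_smul : ∀ (a : A) (f : M →ₗ[B] B) (m : M), e (a • f) m = a * e f m
  e_comp : ∀ (b : B) (f : M →ₗ[B] B) (m : M),
    e (LinearMap.toSpanSingleton B B b ∘ₗ f) m = e f (b • m)
  /-- The size of the left dual basis. -/
  l : ℕ
  /-- The vectors of the left dual basis. -/
  p : Fin l → M
  /-- The covectors of the left dual basis. -/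
  f : Fin l → M →ₗ[B] B
  sum_left : ∀ x, ∑ i, f i x • p i = x
  /-- The size of the right dual basis. -/
  r : ℕ
  /-- The vectors of the right dual basis. -/
  q : Fin r → M
  /-- The covectors of the right dual basis. -/
  g : Fin r → M →ₗ[Aᵐᵒᵖ] A
  sum_right : ∀ x, ∑ j, op (g j x) • q j = x

variable {A B M}

theorem IsFrobeniusBimodule.nonempty_data [SMulCommClass B Aᵐᵒᵖ M] (h : IsFrobeniusBimodule B A M) :
    Nonempty (FrobeniusData A B M) := by
  obtain ⟨_, _, _, _, e, he₁, he₂⟩ := h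
  obtain ⟨l, p, f, hf⟩ := exists_dual_basis B M
  obtain ⟨r, q, g, hg⟩ := exists_dual_basis Aᵐᵒᵖ M
  let u : Aᵐᵒᵖ →ₗ[Aᵐᵒᵖ] A :=
    { toFun := unop, map_add' := fun _ _ => rfl, map_smul' := fun _ _ => rfl }
  exact ⟨⟨e, fun a f m => LinearMap.congr_fun (he₁ a f) m,
    fun b f m => LinearMap.congr_fun (he₂ b f) m, l, p, f, hf, r, q, fun j => u ∘ₗ g j, hg⟩⟩

namespace FrobeniusData

variable (D : FrobeniusData A B M)

/-- The covectors of the right dual basis, transported to the left dual. -/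
def n (j : Fin D.r) : M →ₗ[B] B := D.e.symm (D.g j)

theorem e_n (j : Fin D.r) : D.e (D.n j) = D.g j := D.e.apply_symm_apply _

theorem sum_e_smul_n (f : M →ₗ[B] B) : ∑ j, D.e f (D.q j) • D.n j = f := by
  refine D.e.injective (LinearMap.ext fun m => ?_)
  rw [map_sum, LinearMap.sum_apply]
  conv_rhs => rw [← D.sum_right m, map_sum]
  refine Finset.sum_congr rfl fun j _ => ?_
  rw [D.e_smul, e_n, map_smul]
  rfl

theorem sum_smul_n (b : B) (j : Fin D.r) :
    ∑ i, D.g j (b • D.q i) • D.n i = LinearMap.toSpanSingleton B B b ∘ₗ D.n j := by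
  rw [← D.sum_e_smul_n (LinearMap.toSpanSingleton B B b ∘ₗ D.n j)]
  refine Finset.sum_congr rfl fun i _ => ?_
  rw [D.e_comp, e_n]

theorem sum_comp_f {Y : Type u} [AddCommGroup Y] [Module B Y] (h : M →ₗ[B] Y) :
    ∑ i, LinearMap.toSpanSingleton B Y (h (D.p i)) ∘ₗ D.f i = h := by
  ext m
  rw [LinearMap.sum_apply]
  conv_rhs => rw [← D.sum_left m, map_sum]
  refine Finset.sum_congr rfl fun i _ => ?_
  rw [map_smul]
  rfl

section Counit

variable {X : Type u} [AddCommGroup X] [Module A X]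

/-- The pairing `n, m ⊗ x ↦ e(n)(m) x`. -/
noncomputable def pair (n : M →ₗ[B] B) : NCT A M X B →+ X :=
  liftT (AddMonoidHom.mk' (fun m => AddMonoidHom.mk' (fun x => D.e n m • x) (smul_add _))
      fun m m' => by ext x; simp [add_smul])
    fun m a x => by simp [mul_smul]

theorem pair_mkT (n : M →ₗ[B] B) (m : M) (x : X) : D.pair n (mkT A M X B m x) = D.e n m • x := rfl

theorem pair_add (n n' : M →ₗ[B] B) (w : NCT A M X B) :
    D.pair (n + n') w = D.pair n w + D.pair n' w := by
  induction w using mkT_induction with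
  | h m x => simp [pair_mkT, add_smul]
  | hadd v w hv hw => rw [map_add, map_add, map_add, hv, hw, add_add_add_comm]

theorem pair_sum {ι : Type*} (s : Finset ι) (n : ι → M →ₗ[B] B) (w : NCT A M X B) :
    D.pair (∑ i ∈ s, n i) w = ∑ i ∈ s, D.pair (n i) w :=
  map_sum (AddMonoidHom.mk' (fun n => D.pair n w) fun n n' => D.pair_add n n' w) n s

theorem pair_smul (a : A) (n : M →ₗ[B] B) (w : NCT A M X B) :
    D.pair (a • n) w = a • D.pair n w := by
  induction w using mkT_induction with
  | h m x => rw [pair_mkT, pair_mkT, D.e_smul, mul_smul]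
  | hadd v w hv hw => rw [map_add, map_add, hv, hw, smul_add]

theorem pair_comp (b : B) (n : M →ₗ[B] B) (w : NCT A M X B) :
    D.pair (LinearMap.toSpanSingleton B B b ∘ₗ n) w = D.pair n (b • w) := by
  induction w using mkT_induction with
  | h m x => rw [smul_mkT, pair_mkT, pair_mkT, D.e_comp]
  | hadd v w hv hw => rw [smul_add, map_add, map_add, hv, hw]

theorem sum_pair_f (n : M →ₗ[B] B) (w : NCT A M X B) :
    ∑ i, D.pair (D.f i) (n (D.p i) • w) = D.pair n w := by
  conv_rhs => rw [← D.sum_comp_f n, pair_sum]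
  exact Finset.sum_congr rfl fun i _ => (D.pair_comp _ _ _).symm

variable (X) in
/-- The counit of the adjunction `Hom_B(M, -) ⊣ M ⊗_A -`. -/
noncomputable def counit : (M →ₗ[B] NCT A M X B) →ₗ[A] X where
  toFun h := ∑ i, D.pair (D.f i) (h (D.p i))
  map_add' h h' := by simp [Finset.sum_add_distrib]
  map_smul' a h := by
    have key (i) : D.pair (D.f i) ((a • h) (D.p i)) =
        ∑ j, D.pair (D.f i) ((a • D.f j) (D.p i) • h (D.p j)) := by
      conv_lhs => rw [← D.sum_comp_f h]
      rw [← map_sum, smul_hom_apply, LinearMap.sum_apply]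
      rfl
    rw [Finset.sum_congr rfl fun i _ => key i, Finset.sum_comm, RingHom.id_apply, Finset.smul_sum]
    refine Finset.sum_congr rfl fun j _ => ?_
    rw [sum_pair_f, pair_smul]

theorem counit_apply (h : M →ₗ[B] NCT A M X B) :
    D.counit X h = ∑ i, D.pair (D.f i) (h (D.p i)) := rfl

theorem counit_comp (w : NCT A M X B) (n : M →ₗ[B] B) :
    D.counit X (LinearMap.toSpanSingleton B _ w ∘ₗ n) = D.pair n w :=
  D.sum_pair_f n w

theorem pair_mapT {X' : Type u} [AddCommGroup X'] [Module A X'] (u : X →ₗ[A] X')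
    (n : M →ₗ[B] B) (w : NCT A M X B) : D.pair n (mapT A B M u w) = u (D.pair n w) := by
  induction w using mkT_induction with
  | h m x => rw [mapT_mkT, pair_mkT, pair_mkT, map_smul]
  | hadd v w hv hw => rw [map_add, map_add, map_add, hv, hw, map_add]

end Counit

section Unit

variable (Y : Type u) [AddCommGroup Y] [Module B Y]

/-- The unit of the adjunction `Hom_B(M, -) ⊣ M ⊗_A -`. -/
noncomputable def unit : Y →ₗ[B] NCT A M (M →ₗ[B] Y) B where
  toFun y := ∑ j, mkTHom A B M (M →ₗ[B] Y) (D.q j) (LinearMap.toSpanSingleton B Y y ∘ₗ D.n j)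
  map_add' y y' := by
    rw [← Finset.sum_add_distrib]
    refine Finset.sum_congr rfl fun j _ => ?_
    rw [← map_add]
    congr 1
    ext m
    exact smul_add _ _ _
  map_smul' b y := by
    have h₁ (j) : b • mkTHom A B M (M →ₗ[B] Y) (D.q j)
          (LinearMap.toSpanSingleton B Y y ∘ₗ D.n j) =
        ∑ i, mkTHom A B M (M →ₗ[B] Y) (D.q i)
          (LinearMap.toSpanSingleton B Y y ∘ₗ (D.g i (b • D.q j) • D.n j)) := by
      rw [mkTHom_apply, smul_mkT, ← mkTHom_apply]
      conv_lhs => rw [← D.sum_right (b • D.q j), map_sum, AddMonoidHom.finsetSum_apply]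
      refine Finset.sum_congr rfl fun i _ => ?_
      rw [mkTHom_apply, ← mkT_smul]
      rfl
    rw [RingHom.id_apply, Finset.smul_sum, Finset.sum_congr rfl fun j _ => h₁ j, Finset.sum_comm]
    refine Finset.sum_congr rfl fun i _ => ?_
    rw [← map_sum]
    congr 1
    have h₂ := congrArg (homMap A B M (LinearMap.toSpanSingleton B Y y)) (D.sum_smul_n b i)
    rw [map_sum] at h₂
    refine Eq.trans ?_ h₂.symm
    ext m
    change D.n i m • b • y = (D.n i m • b) • y
    rw [smul_assoc]

theorem unit_apply (y : Y) : D.unit Y y =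
    ∑ j, mkTHom A B M (M →ₗ[B] Y) (D.q j) (LinearMap.toSpanSingleton B Y y ∘ₗ D.n j) := rfl

theorem mapT_unit {Y' : Type u} [AddCommGroup Y'] [Module B Y'] (u : Y →ₗ[B] Y') (y : Y) :
    mapT A B M (homMap A B M u) (D.unit Y y) = D.unit Y' (u y) := by
  rw [unit_apply, unit_apply, map_sum]
  refine Finset.sum_congr rfl fun j _ => ?_
  rw [mkTHom_apply, mapT_mkT, mkTHom_apply]
  congr 1
  ext m
  exact map_smul u _ _

theorem counit_unit (f : M →ₗ[B] Y) : D.counit (M →ₗ[B] Y) (D.unit Y ∘ₗ f) = f := by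
  rw [counit_apply]
  conv_rhs => rw [← D.sum_comp_f f]
  refine Finset.sum_congr rfl fun i _ => ?_
  have h := congrArg (homMap A B M (LinearMap.toSpanSingleton B Y (f (D.p i))))
    (D.sum_e_smul_n (D.f i))
  rw [map_sum] at h
  refine Eq.trans ?_ h
  rw [LinearMap.comp_apply, unit_apply, map_sum]
  rfl

theorem mapT_counit_unit {X : Type u} [AddCommGroup X] [Module A X] (w : NCT A M X B) :
    mapT A B M (D.counit X) (D.unit (NCT A M X B) w) = w := by
  have h : mapT A B M (D.counit X) ∘ₗ D.unit (NCT A M X B) = LinearMap.id := by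
    refine linearMap_ext_mkT fun m x => ?_
    rw [LinearMap.comp_apply, unit_apply, map_sum, LinearMap.id_apply]
    conv_rhs => rw [← mkTHom_apply, ← D.sum_right m, map_sum, AddMonoidHom.finsetSum_apply]
    refine Finset.sum_congr rfl fun j _ => ?_
    rw [mkTHom_apply, mapT_mkT, counit_comp, pair_mkT, e_n, mkTHom_apply, mkT_smul]
  exact LinearMap.congr_fun h w

end Unit

/-- For a Frobenius bimodule, `Hom_B(M, -)` is also left adjoint to `M ⊗_A -`. -/
noncomputable def homTensorAdjunction : homFunctor A B M ⊣ tensorFunctor A B M :=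
  Adjunction.mkOfUnitCounit
    { unit :=
        { app := fun Y => ModuleCat.ofHom (Y := NCT A M (M →ₗ[B] Y) B) (D.unit Y)
          naturality := fun Y Y' u => by
            have h : D.unit Y' ∘ₗ u.hom = mapT A B M (homMap A B M u.hom) ∘ₗ D.unit Y :=
              LinearMap.ext fun y => (D.mapT_unit Y u.hom y).symm
            exact congrArg ModuleCat.ofHom h }
      counit :=
        { app := fun X => ModuleCat.ofHom (X := M →ₗ[B] NCT A M X B) (D.counit X)
          naturality := fun X X' u => by
            have h : D.counit X' ∘ₗ homMap A B M (mapT A B M u.hom) = u.hom ∘ₗ D.counit X := by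
              refine LinearMap.ext fun f => ?_
              rw [LinearMap.comp_apply, LinearMap.comp_apply, counit_apply, counit_apply, map_sum]
              exact Finset.sum_congr rfl fun i _ => D.pair_mapT _ _ _
            exact congrArg ModuleCat.ofHom h }
      left_triangle := by
        ext Y : 2
        have h : D.counit (M →ₗ[B] Y) ∘ₗ homMap A B M (D.unit Y) = LinearMap.id :=
          LinearMap.ext fun f => D.counit_unit Y f
        exact congrArg ModuleCat.ofHom h
      right_triangle := by
        ext X : 2
        have h : mapT A B M (D.counit X) ∘ₗ D.unit (NCT A M X B) = LinearMap.id :=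
          LinearMap.ext fun w => D.mapT_counit_unit w
        exact congrArg ModuleCat.ofHom h }

theorem finite_hom (D : FrobeniusData A B M) {Y : Type u} [AddCommGroup Y] [Module B Y]
    [Module.Finite B Y] :
    Module.Finite A (M →ₗ[B] Y) := by
  obtain ⟨s, p, hp⟩ := Module.Finite.exists_fin' B Y
  have hN : Module.Finite A (M →ₗ[B] B) :=
    Module.Finite.of_surjective (Fintype.linearCombination A D.n) fun f =>
      ⟨fun j => D.e f (D.q j), D.sum_e_smul_n f⟩
  let F : (Fin s → M →ₗ[B] B) →ₗ[A] (M →ₗ[B] Y) :=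
    { toFun := fun v => p ∘ₗ LinearMap.pi v
      map_add' := fun v w => LinearMap.ext fun m => map_add p (fun i => v i m) fun i => w i m
      map_smul' := fun a v => rfl }
  refine Module.Finite.of_surjective F fun f => ?_
  choose c hc using fun i => hp (f (D.p i))
  refine ⟨fun t => ∑ i, LinearMap.toSpanSingleton B B (c i t) ∘ₗ D.f i, ?_⟩
  conv_rhs => rw [← D.sum_comp_f f]
  ext m
  change p _ = _
  rw [LinearMap.sum_apply]
  have h (i) : (LinearMap.toSpanSingleton B Y (f (D.p i)) ∘ₗ D.f i) m = p (D.f i m • c i) := by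
    rw [map_smul, hc]
    rfl
  rw [Finset.sum_congr rfl fun i _ => h i, ← map_sum]
  congr 1
  ext t
  simp

end FrobeniusData

end FrobeniusBimoduleAdjunction

section Faithful

variable {A B M : Type u} [Ring A] [Ring B] [AddCommGroup M] [Module B M] [Module Aᵐᵒᵖ M]

theorem eq_zero_of_mapT_eq_zero [SMulCommClass Aᵐᵒᵖ B M]
    (hM : ∀ a : A, (∀ m : M, op a • m = 0) → a = 0) {X : Type u} [AddCommGroup X] [Module A X]
    [Module.Finite A X] [Module.Projective A X] {w : X →ₗ[A] X} (hw : mapT A B M w = 0) :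
    w = 0 := by
  obtain ⟨n, p, θ, hθ⟩ := exists_dual_basis A X
  ext x
  rw [← hθ (w x), LinearMap.zero_apply]
  refine Finset.sum_eq_zero fun i _ => ?_
  rw [hM (θ i (w x)) fun m => ?_, zero_smul]
  let c : NCT A M X B →+ M :=
    liftT (AddMonoidHom.mk' (fun m => AddMonoidHom.mk' (fun x => op (θ i x) • m)
        fun x x' => by simp [add_smul])
        fun m m' => by ext x; simp)
      fun m a x => by simp [mul_smul]
  have h : c (mapT A B M w (mkT A M X B m x)) = 0 := by rw [hw, LinearMap.zero_apply, map_zero]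
  exact h

theorem eq_zero_of_forall_comp_eq_zero (hM : ∀ b : B, (∀ m : M, b • m = 0) → b = 0) {r : ℕ}
    (q : Fin r → M) (g : Fin r → M → A) (hq : ∀ x, ∑ j, op (g j x) • q j = x)
    [SMulCommClass B Aᵐᵒᵖ M] {Y : Type u} [AddCommGroup Y] [Module B Y]
    [Module.Finite B Y] [Module.Projective B Y] (hinj : Module.Injective B Y) {w : Y →ₗ[B] Y}
    (hw : ∀ f : M →ₗ[B] Y, w ∘ₗ f = 0) : w = 0 := by
  classical
  obtain ⟨n, p, θ, hθ⟩ := exists_dual_basis B Y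
  let ι : Y →ₗ[B] (Fin n × Fin r → M) :=
    LinearMap.pi fun t => LinearMap.toSpanSingleton B M (q t.2) ∘ₗ θ t.1
  have hι : Function.Injective ι := by
    rw [injective_iff_map_eq_zero]
    intro y hy
    rw [← hθ y]
    refine Finset.sum_eq_zero fun i _ => ?_
    rw [hM (θ i y) fun m => ?_, zero_smul]
    rw [← hq m, Finset.smul_sum]
    refine Finset.sum_eq_zero fun j _ => ?_
    have h : θ i y • q j = 0 := congrFun hy (i, j)
    rw [smul_comm, h, smul_zero]
  obtain ⟨ρ, hρ⟩ := hinj.out ι hι LinearMap.id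
  have h : w ∘ₗ ρ = 0 := LinearMap.pi_ext' fun t => by
    rw [LinearMap.comp_assoc, hw, LinearMap.zero_comp]
  ext y
  have := LinearMap.congr_fun h (ι y)
  rwa [LinearMap.comp_apply, hρ] at this

end Faithful

theorem stmt7 (k : Type u) [Field k]
    (A B : Type u) [Ring A] [Ring B] [Algebra k A] [Algebra k B]
    [FiniteDimensional k A] [FiniteDimensional k B]
    (M : Type u) [AddCommGroup M]
    [Module B M] [Module Aᵐᵒᵖ M] [SMulCommClass B Aᵐᵒᵖ M] [SMulCommClass Aᵐᵒᵖ B M]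
    (hM : IsFrobeniusBimodule B A M)
    (hfaithB : ∀ b : B, (∀ m : M, b • m = 0) → b = 0)
    (hfaithA : ∀ a : A, (∀ m : M, op a • m = 0) → a = 0)
    (X : Type u) [AddCommGroup X] [Module A X] [Module.Finite A X]
    (hX : ∀ V : ModuleCat.{u} A, InAdd A (ModuleCat.of A X) V ↔ IsStp k A V)
    (Y : Type u) [AddCommGroup Y] [Module B Y] [Module.Finite B Y]
    (hY : ∀ W : ModuleCat.{u} B, InAdd B (ModuleCat.of B Y) W ↔ IsStp k B W) :
    (∃ Φ : Module.End A X →+* Module.End B (NCT A M X B),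
      (∀ (f : Module.End A X) (m : M) (x : X),
        Φ f (mkT A M X B m x) = mkT A M X B m (f x)) ∧
      Function.Injective Φ ∧ IsFrobeniusRingHom Φ ∧
      IsLeftSplitRingHom Φ ∧ IsRightSplitRingHom Φ) ∧
    (∃ Ψ : Module.End B Y →+* Module.End A (M →ₗ[B] Y),
      (∀ (g : Module.End B Y) (f : M →ₗ[B] Y), Ψ g f = g ∘ₗ f) ∧
      Function.Injective Ψ ∧ IsFrobeniusRingHom Ψ ∧
      IsLeftSplitRingHom Ψ ∧ IsRightSplitRingHom Ψ) := by
  obtain ⟨D⟩ := hM.nonempty_data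
  have := hM.1
  have hX' := (isSelfDual_of_inAdd_iff_isStp hX).1
  have hY' := (isSelfDual_of_inAdd_iff_isStp hY).1
  have : Module.Projective A X := hX'.projective
  have : Module.Projective B Y := hY'.projective
  have hFX : Module.Finite B (NCT A M X B) := finite_tensor
  have hGY : Module.Finite A (M →ₗ[B] Y) := D.finite_hom
  have hFGY : Module.Finite B (NCT A M (M →ₗ[B] Y) B) := finite_tensor
  refine ⟨⟨endMap (tensorFunctor A B M) (ModuleCat.of A X), fun _ _ _ => rfl,
    isFrobeniusRingHom_endMap (tensorHomAdjunction A B M) D.homTensorAdjunction hX hFX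
      (D.finite_hom (Y := NCT A M X B)) fun w hw => ?_⟩,
    ⟨endMap (homFunctor A B M) (ModuleCat.of B Y), fun _ _ => rfl,
    isFrobeniusRingHom_endMap D.homTensorAdjunction (tensorHomAdjunction A B M) hY hGY hFGY
      fun w hw => ?_⟩⟩
  · exact ModuleCat.hom_ext (eq_zero_of_mapT_eq_zero hfaithA (congrArg ModuleCat.Hom.hom hw))
  · exact ModuleCat.hom_ext (eq_zero_of_forall_comp_eq_zero hfaithB D.q (fun j => D.g j)
      D.sum_right hY'.injective fun f =>
        LinearMap.congr_fun (congrArg ModuleCat.Hom.hom hw) f)
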